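/- arXiv:1602.01741 — 3 statements merged into one kernel-verified Lean document; each statement's English description precedes it below -/
import Mathlib

section
/- Let H be a complex Hilbert space, let N ≥ 1 be a natural number, and let K₁, …, K_N be complete (closed) subspaces of H that are pairwise (1/N)-orthogonal, i.e. |⟨ξ, η⟩| ≤ (1/N)·‖ξ‖·‖η‖ for all ξ ∈ K_i, η ∈ K_j with i ≠ j. Then for every vector v ∈ H one has ∑_{j=1}^N ‖P_{K_j} v‖² ≤ √(2N)·‖v‖², where P_{K_j} denotes the orthogonal projection onto K_j. -/
open scoped ComplexInnerProductSpace

/-- Vectors `w i` of norm at most `r` whose pairwise inner products are at most `ε r²` satisfy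
`‖∑ i, w i‖² ≤ (n + n² ε) r²`, where `n` is the number of vectors. -/
theorem norm_sum_sq_le_of_pairwise_norm_inner_le {ι 𝕜 E : Type*} [Fintype ι] [RCLike 𝕜]
    [SeminormedAddCommGroup E] [InnerProductSpace 𝕜 E] {w : ι → E} {r ε : ℝ}
    (hε : 0 ≤ ε) (hw : ∀ i, ‖w i‖ ≤ r)
    (hinner : ∀ i j, i ≠ j → ‖inner 𝕜 (w i) (w j)‖ ≤ ε * r ^ 2) :
    ‖∑ i, w i‖ ^ 2 ≤ (Fintype.card ι + (Fintype.card ι : ℝ) ^ 2 * ε) * r ^ 2 := by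
  classical
  have hentry (i j : ι) :
      ‖inner 𝕜 (w i) (w j)‖ ≤ (if i = j then r ^ 2 else 0) + ε * r ^ 2 := by
    split_ifs with h
    · subst h
      have hdiag : ‖inner 𝕜 (w i) (w i)‖ ≤ r ^ 2 := by
        rw [inner_self_eq_norm_sq_to_K, norm_pow, RCLike.norm_ofReal, abs_norm]
        exact pow_le_pow_left₀ (norm_nonneg _) (hw i) 2
      linarith [mul_nonneg hε (sq_nonneg r)]
    · simpa using hinner i j h
  calc
    ‖∑ i, w i‖ ^ 2 = ‖inner 𝕜 (∑ i, w i) (∑ i, w i)‖ := by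
      rw [inner_self_eq_norm_sq_to_K, norm_pow, RCLike.norm_ofReal, abs_norm]
    _ ≤ ∑ i, ∑ j, ‖inner 𝕜 (w i) (w j)‖ := by
      simp_rw [sum_inner, inner_sum]
      exact (norm_sum_le _ _).trans (Finset.sum_le_sum fun i _ => norm_sum_le _ _)
    _ ≤ ∑ i, ∑ j, ((if i = j then r ^ 2 else 0) + ε * r ^ 2) :=
      Finset.sum_le_sum fun i _ => Finset.sum_le_sum fun j _ => hentry i j
    _ = _ := by
      simp [Finset.sum_add_distrib]
      ring

/-- The squared norms of the projections of `v` have sum at most `‖∑ j, P_j v‖ ‖v‖`. -/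
theorem sum_norm_sq_starProjection_le {ι 𝕜 E : Type*} [Fintype ι] [RCLike 𝕜]
    [NormedAddCommGroup E] [InnerProductSpace 𝕜 E] (K : ι → Submodule 𝕜 E)
    [∀ j, (K j).HasOrthogonalProjection] (v : E) :
    ∑ j, ‖(K j).starProjection v‖ ^ 2 ≤ ‖∑ j, (K j).starProjection v‖ * ‖v‖ := by
  have hproj (j : ι) :
      ‖(K j).starProjection v‖ ^ 2 = RCLike.re (inner 𝕜 ((K j).starProjection v) v) := by
    have h := (K j).starProjection_inner_eq_zero v _ ((K j).starProjection_apply_mem v)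
    rw [inner_sub_left, sub_eq_zero] at h
    rw [← inner_self_eq_norm_sq (𝕜 := 𝕜), ← h, inner_re_symm]
  simp_rw [hproj, ← map_sum, ← sum_inner]
  exact re_inner_le_norm _ _

/-- Averaging step in Claim 2: the sum of the squared norms of the projections
onto pairwise (1/N)-orthogonal closed subspaces is at most `√(2N)·‖v‖²`. -/
theorem sum_norm_sq_proj_le_of_pairwise_eps_orthogonal
    {H : Type*} [NormedAddCommGroup H] [InnerProductSpace ℂ H]
    (N : ℕ) (hN : 1 ≤ N) (K : Fin N → Submodule ℂ H) [∀ j, CompleteSpace (K j)]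
    (horth : ∀ i j : Fin N, i ≠ j → ∀ ξ ∈ K i, ∀ η ∈ K j,
      ‖⟪ξ, η⟫‖ ≤ (1 / (N : ℝ)) * ‖ξ‖ * ‖η‖)
    (v : H) :
    ∑ j : Fin N, ‖(Submodule.orthogonalProjectionOnto (K j) v : H)‖ ^ 2 ≤
      Real.sqrt (2 * N) * ‖v‖ ^ 2 := by
  change ∑ j, ‖(K j).starProjection v‖ ^ 2 ≤ _
  have hN0 : (N : ℝ) ≠ 0 := by positivity
  have hle (j : Fin N) : ‖(K j).starProjection v‖ ≤ ‖v‖ := (K j).norm_starProjection_apply_le v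
  have hsum : ‖∑ j, (K j).starProjection v‖ ^ 2 ≤ 2 * N * ‖v‖ ^ 2 := by
    refine (norm_sum_sq_le_of_pairwise_norm_inner_le (𝕜 := ℂ) (ε := 1 / (N : ℝ))
      (by positivity) hle fun i j hij => ?_).trans_eq ?_
    · refine (horth i j hij _ ((K i).starProjection_apply_mem v) _
        ((K j).starProjection_apply_mem v)).trans ?_
      rw [mul_assoc, sq]
      gcongr <;> exact hle _
    · rw [Fintype.card_fin]
      field_simp
      ring
  have hnorm : ‖∑ j, (K j).starProjection v‖ ≤ Real.sqrt (2 * N) * ‖v‖ := by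
    refine (sq_le_sq₀ (norm_nonneg _) (by positivity)).mp ?_
    rwa [mul_pow, Real.sq_sqrt (by positivity)]
  calc
    _ ≤ ‖∑ j, (K j).starProjection v‖ * ‖v‖ := sum_norm_sq_starProjection_le K v
    _ ≤ Real.sqrt (2 * N) * ‖v‖ * ‖v‖ := by gcongr
    _ = _ := by ring
end

section
/- Let H be a complex Hilbert space, let N ≥ 1 be a natural number, and let K₁, …, K_N be complete (closed) subspaces of H that are pairwise (1/N)-orthogonal, i.e. |⟨ξ, η⟩| ≤ (1/N)·‖ξ‖·‖η‖ for all ξ ∈ K_i, η ∈ K_j with i ≠ j. Let v ∈ H be a vector such that the norms ‖P_{K_j} v‖ are equal for all j = 1, …, N, where P_{K_j} denotes the orthogonal projection onto K_j. Then ‖P_{K_1} v‖² ≤ (√2/√N)·‖v‖². -/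
open scoped ComplexInnerProductSpace

/-- A sum of vectors whose squared norms are at most `a` and whose pairwise inner products are
at most `c` has squared norm at most `n * a + n ^ 2 * c`, where `n` is the number of vectors. -/
lemma norm_sq_sum_le_of_norm_inner_le {ι H : Type*} [Fintype ι] [NormedAddCommGroup H]
    [InnerProductSpace ℂ H] {p : ι → H} {a c : ℝ} (hc : 0 ≤ c) (ha : ∀ i, ‖p i‖ ^ 2 ≤ a)
    (hp : ∀ i j, i ≠ j → ‖⟪p i, p j⟫‖ ≤ c) :
    ‖∑ i, p i‖ ^ 2 ≤ Fintype.card ι * a + (Fintype.card ι : ℝ) ^ 2 * c := by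
  classical
  have hij (i j : ι) : ‖⟪p i, p j⟫‖ ≤ (if i = j then a else 0) + c := by
    split_ifs with h
    · subst h
      have hi := ha i
      rw [inner_self_eq_norm_sq_to_K, norm_pow, RCLike.norm_ofReal, abs_norm]
      linarith
    · simpa using hp i j h
  calc ‖∑ i, p i‖ ^ 2 = ‖⟪∑ i, p i, ∑ i, p i⟫‖ := by
        rw [inner_self_eq_norm_sq_to_K, norm_pow, RCLike.norm_ofReal, abs_norm]
    _ = ‖∑ i, ∑ j, ⟪p i, p j⟫‖ := by
        simp_rw [sum_inner, inner_sum]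
    _ ≤ ∑ i, ∑ j, ‖⟪p i, p j⟫‖ :=
        (norm_sum_le _ _).trans (Finset.sum_le_sum fun i _ => norm_sum_le _ _)
    _ ≤ ∑ i : ι, ∑ j : ι, ((if i = j then a else 0) + c) :=
        Finset.sum_le_sum fun i _ => Finset.sum_le_sum fun j _ => hij i j
    _ = Fintype.card ι * a + (Fintype.card ι : ℝ) ^ 2 * c := by
        simp [Finset.sum_add_distrib]
        ring

/-- Claim 2: if the projections of `v` onto N pairwise (1/N)-orthogonal closed
subspaces all have the same norm, then each squared norm is at most `√2·‖v‖²/√N`. -/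
theorem norm_sq_proj_le_of_pairwise_eps_orthogonal_of_norm_eq
    {H : Type*} [NormedAddCommGroup H] [InnerProductSpace ℂ H]
    (N : ℕ) (hN : 1 ≤ N) (K : Fin N → Submodule ℂ H) [∀ j, CompleteSpace (K j)]
    (horth : ∀ i j : Fin N, i ≠ j → ∀ ξ ∈ K i, ∀ η ∈ K j,
      ‖⟪ξ, η⟫‖ ≤ (1 / (N : ℝ)) * ‖ξ‖ * ‖η‖)
    (v : H)
    (heq : ∀ i j : Fin N, ‖(Submodule.orthogonalProjectionOnto (K i) v : H)‖ =
      ‖(Submodule.orthogonalProjectionOnto (K j) v : H)‖) :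
    ‖(Submodule.orthogonalProjectionOnto (K ⟨0, hN⟩) v : H)‖ ^ 2 ≤
      (Real.sqrt 2 / Real.sqrt N) * ‖v‖ ^ 2 := by
  have hN0 : (0 : ℝ) < N := by exact_mod_cast hN
  set p : Fin N → H := fun j => (Submodule.orthogonalProjectionOnto (K j) v : H)
  set r : ℝ := ‖(Submodule.orthogonalProjectionOnto (K ⟨0, hN⟩) v : H)‖
  have hpr (j : Fin N) : ‖p j‖ = r := heq j ⟨0, hN⟩
  have hr0 : 0 ≤ r := norm_nonneg _
  have hrv : r ≤ ‖v‖ := Submodule.norm_orthogonalProjectionOnto_apply_le _ _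
  have hsum : ‖∑ j, p j‖ ^ 2 ≤ 2 * N * r ^ 2 := by
    have h := norm_sq_sum_le_of_norm_inner_le (p := p) (a := r ^ 2) (c := 1 / N * r * r)
      (by positivity) (fun j => by rw [hpr]) fun i j hij => by
        simpa only [hpr] using horth i j hij (p i) (Subtype.prop _) (p j) (Subtype.prop _)
    rw [Fintype.card_fin] at h
    refine h.trans_eq ?_
    field_simp
    ring
  have hinner (j : Fin N) : ⟪p j, v⟫ = ((r ^ 2 : ℝ) : ℂ) := by
    have h : ⟪p j, v - p j⟫ = 0 :=
      Submodule.inner_right_of_mem_orthogonal (Subtype.prop _)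
        (Submodule.sub_starProjection_mem_orthogonal v)
    rw [inner_sub_right, sub_eq_zero] at h
    rw [h, inner_self_eq_norm_sq_to_K, hpr]
    simp
  have hcs : N * r ^ 2 ≤ ‖∑ j, p j‖ * ‖v‖ := by
    have h := norm_inner_le_norm (𝕜 := ℂ) (∑ j, p j) v
    rw [sum_inner, Finset.sum_congr rfl fun j _ => hinner j] at h
    simpa using h
  have hsq : (N * r ^ 2) * (N * r ^ 2) ≤ (2 * N * ‖v‖ ^ 2) * r ^ 2 := by
    calc (N * r ^ 2) * (N * r ^ 2) ≤ (‖∑ j, p j‖ * ‖v‖) * (‖∑ j, p j‖ * ‖v‖) := by gcongr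
      _ = ‖∑ j, p j‖ ^ 2 * ‖v‖ ^ 2 := by ring
      _ ≤ (2 * N * r ^ 2) * ‖v‖ ^ 2 := by gcongr
      _ = (2 * N * ‖v‖ ^ 2) * r ^ 2 := by ring
  have hfin : N * (r ^ 2) ^ 2 ≤ 2 * (‖v‖ ^ 2) ^ 2 := by
    refine le_of_mul_le_mul_left ?_ hN0
    calc N * (N * (r ^ 2) ^ 2) = (N * r ^ 2) * (N * r ^ 2) := by ring
      _ ≤ (2 * N * ‖v‖ ^ 2) * r ^ 2 := hsq
      _ ≤ (2 * N * ‖v‖ ^ 2) * ‖v‖ ^ 2 := by gcongr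
      _ = N * (2 * (‖v‖ ^ 2) ^ 2) := by ring
  refine (sq_le_sq₀ (by positivity) (by positivity)).mp ?_
  rw [mul_pow, div_pow, Real.sq_sqrt zero_le_two, Real.sq_sqrt hN0.le, div_mul_eq_mul_div,
    le_div_iff₀ hN0]
  linarith
end

section
/- Let H be a complex Hilbert space, let X ⊆ H be a complete (closed) subspace with orthogonal projection P_X : H → H, let (v_n)_{n ∈ ℕ} be a norm-bounded sequence in H, and let ω be an ultrafilter on ℕ. Let 𝒢 be a set of unitary operators on H such that: (i) for every u ∈ 𝒢, ‖u(v_n) − v_n‖ → 0 along ω; and (ii) for every natural number N ≥ 1 there exist u₁, …, u_N ∈ 𝒢 such that u_i(X) is (1/N)-orthogonal to u_j(X) for all i ≠ j, i.e. |⟨ξ, η⟩| ≤ (1/N)‖ξ‖‖η‖ for all ξ ∈ u_i(X), η ∈ u_j(X). Then ‖P_X(v_n)‖ → 0 along ω. -/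
open scoped ComplexInnerProductSpace

/-- The sum of `N` vectors of norm `a` whose pairwise inner products are at most `a ^ 2 / N`
has squared norm at most `2 * N * a ^ 2`. -/
theorem norm_sum_sq_le_of_almost_orthogonal
    {H : Type*} [NormedAddCommGroup H] [InnerProductSpace ℂ H] {N : ℕ} (hN : 1 ≤ N)
    (w : Fin N → H) (a : ℝ) (hnorm : ∀ j, ‖w j‖ = a)
    (horth : ∀ i j, i ≠ j → ‖⟪w i, w j⟫‖ ≤ (1 / (N : ℝ)) * a * a) :
    ‖∑ j, w j‖ ^ 2 ≤ 2 * N * a ^ 2 := by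
  have hN0 : (0 : ℝ) < N := by exact_mod_cast hN
  have entry : ∀ i j, ‖⟪w i, w j⟫‖ ≤ (if i = j then a ^ 2 else 0) + a ^ 2 / N := by
    intro i j
    by_cases h : i = j
    · subst h
      have h₁ := norm_inner_le_norm (𝕜 := ℂ) (w i) (w i)
      rw [hnorm] at h₁
      have h₂ : 0 ≤ a ^ 2 / N := by positivity
      simp only [if_true]
      nlinarith
    · have h₁ := horth i j h
      simp only [h, if_false, zero_add]
      calc _ ≤ _ := h₁
        _ = _ := by ring
  calc ‖∑ j, w j‖ ^ 2 = ‖⟪∑ i, w i, ∑ j, w j⟫‖ := by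
        rw [inner_self_eq_norm_sq_to_K]
        simp
    _ = ‖∑ i, ∑ j, ⟪w i, w j⟫‖ := by
        rw [sum_inner]
        simp_rw [inner_sum]
    _ ≤ ∑ i, ∑ j, ‖⟪w i, w j⟫‖ :=
        (norm_sum_le _ _).trans (Finset.sum_le_sum fun i _ => norm_sum_le _ _)
    _ ≤ ∑ i : Fin N, ∑ j : Fin N, ((if i = j then a ^ 2 else 0) + a ^ 2 / N) :=
        Finset.sum_le_sum fun i _ => Finset.sum_le_sum fun j _ => entry i j
    _ = 2 * N * a ^ 2 := by
        simp [Finset.sum_add_distrib]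
        field_simp
        ring

/-- If `N` translates of `X` by unitaries are pairwise `1 / N`-orthogonal, the projection of `v`
onto `X` is controlled by `‖v‖` and by how far the unitaries move `v`. -/
theorem card_mul_norm_proj_le
    {H : Type*} [NormedAddCommGroup H] [InnerProductSpace ℂ H]
    (X : Submodule ℂ H) [X.HasOrthogonalProjection] {N : ℕ} (hN : 1 ≤ N)
    (u : Fin N → (H ≃ₗᵢ[ℂ] H))
    (horth : ∀ i j : Fin N, i ≠ j → ∀ ξ ∈ X, ∀ η ∈ X,
      ‖⟪u i ξ, u j η⟫‖ ≤ (1 / (N : ℝ)) * ‖u i ξ‖ * ‖u j η‖) (v : H) :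
    N * ‖(X.orthogonalProjectionOnto v : H)‖ ≤ √(2 * N) * ‖v‖ + ∑ j, ‖u j v - v‖ := by
  set p := (X.orthogonalProjectionOnto v : H)
  have hpX : p ∈ X := Submodule.coe_mem _
  have hpv : ⟪p, v⟫ = ((‖p‖ ^ 2 : ℝ) : ℂ) := by
    have h : ⟪p, v - p⟫ = 0 :=
      X.sub_starProjection_mem_orthogonal v p hpX
    rw [inner_sub_right, sub_eq_zero, inner_self_eq_norm_sq_to_K] at h
    rw [h]
    simp
  rcases (norm_nonneg p).eq_or_lt with h0 | hpos
  · rw [← h0, mul_zero]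
    positivity
  have hS : ‖∑ j, u j p‖ ≤ √(2 * N) * ‖p‖ := by
    refine (sq_le_sq₀ (norm_nonneg _) (by positivity)).mp ?_
    rw [mul_pow, Real.sq_sqrt (by positivity)]
    refine norm_sum_sq_le_of_almost_orthogonal hN _ _ (fun j => (u j).norm_map p) ?_
    intro i j hij
    simpa only [LinearIsometryEquiv.norm_map] using horth i j hij p hpX p hpX
  have key : ((N * ‖p‖ ^ 2 : ℝ) : ℂ) = ⟪∑ j, u j p, v⟫ + ∑ j, ⟪u j p, u j v - v⟫ := by
    rw [sum_inner, ← Finset.sum_add_distrib]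
    simp [hpv]
  have bound : N * ‖p‖ ^ 2 ≤ √(2 * N) * ‖p‖ * ‖v‖ + ∑ j, ‖p‖ * ‖u j v - v‖ := by
    calc N * ‖p‖ ^ 2 = ‖((N * ‖p‖ ^ 2 : ℝ) : ℂ)‖ := by
          rw [Complex.norm_of_nonneg (by positivity)]
      _ ≤ ‖⟪∑ j, u j p, v⟫‖ + ∑ j, ‖⟪u j p, u j v - v⟫‖ := by
          rw [key]
          exact (norm_add_le _ _).trans (by gcongr; exact norm_sum_le _ _)
      _ ≤ _ := by
          gcongr with j
          · exact (norm_inner_le_norm _ _).trans (by gcongr)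
          · exact (norm_inner_le_norm _ _).trans_eq (by rw [LinearIsometryEquiv.norm_map])
  rw [← Finset.mul_sum] at bound
  refine le_of_mul_le_mul_left ?_ hpos
  linarith

/-- Hilbert-space heart of Claim 2: if a bounded sequence `(vₙ)` is asymptotically
invariant along an ultrafilter `ω` under a set `𝒢` of unitaries, and for each `N ≥ 1`
the set `𝒢` contains `N` unitaries whose translates of the closed subspace `X` are
pairwise (1/N)-orthogonal, then `‖P_X(vₙ)‖ → 0` along `ω`. -/
theorem tendsto_norm_proj_zero_of_asymptotically_invariant
    {H : Type*} [NormedAddCommGroup H] [InnerProductSpace ℂ H]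
    (X : Submodule ℂ H) [CompleteSpace X]
    (v : ℕ → H) (hbdd : ∃ C : ℝ, ∀ n : ℕ, ‖v n‖ ≤ C)
    (ω : Ultrafilter ℕ)
    (𝒢 : Set (H ≃ₗᵢ[ℂ] H))
    (hinv : ∀ u ∈ 𝒢, Filter.Tendsto (fun n => ‖u (v n) - v n‖) ω (nhds 0))
    (horth : ∀ N : ℕ, 1 ≤ N → ∃ u : Fin N → (H ≃ₗᵢ[ℂ] H),
      (∀ j : Fin N, u j ∈ 𝒢) ∧
      ∀ i j : Fin N, i ≠ j → ∀ ξ ∈ X, ∀ η ∈ X,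
        ‖⟪u i ξ, u j η⟫‖ ≤ (1 / (N : ℝ)) * ‖u i ξ‖ * ‖u j η‖) :
    Filter.Tendsto (fun n => ‖(Submodule.orthogonalProjectionOnto X (v n) : H)‖) ω (nhds 0) := by
  obtain ⟨C, hC⟩ := hbdd
  have hC0 : 0 ≤ C := (norm_nonneg _).trans (hC 0)
  rw [Metric.tendsto_nhds]
  intro ε hε
  obtain ⟨N, hN⟩ := exists_nat_gt (8 * C ^ 2 / ε ^ 2)
  have hN0 : (0 : ℝ) < N := lt_of_le_of_lt (by positivity) hN
  have hN1 : 1 ≤ N := by exact_mod_cast hN0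
  obtain ⟨u, hu, huX⟩ := horth N hN1
  have hsum : Filter.Tendsto (fun n => ∑ j, ‖u j (v n) - v n‖) ω (nhds 0) := by
    simpa using tendsto_finsetSum Finset.univ fun j _ => hinv (u j) (hu j)
  have hsmall : √(2 * N) * C < N * ε / 2 := by
    apply lt_of_pow_lt_pow_left₀ 2 (by positivity)
    rw [mul_pow, Real.sq_sqrt (by positivity)]
    rw [div_lt_iff₀ (by positivity)] at hN
    nlinarith [mul_lt_mul_of_pos_left hN hN0]
  filter_upwards [hsum.eventually_lt_const (show (0 : ℝ) < N * ε / 2 by positivity)] with n hn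
  have h := card_mul_norm_proj_le X hN1 u huX (v n)
  have h' : √(2 * N) * ‖v n‖ ≤ √(2 * N) * C := by gcongr; exact hC n
  rw [dist_zero_right, norm_norm]
  refine lt_of_mul_lt_mul_left ?_ hN0.le
  linarith
end
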